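/- arXiv:2412.01981 — 3 statements merged into one kernel-verified Lean document; each statement's English description precedes it below -/
import Mathlib

section
/- Let π_θ and π_ref be two causal language models over a finite nonempty vocabulary V with horizon T ≥ 1, and let β > 0. Define r(y) = β·log(π_θ(y)/π_ref(y)) for full sequences y ∈ V^T and q^t(y_{≤t}) = Σ_{i=1}^t β·log(π_θ(y_i | y_{<i})/π_ref(y_i | y_{<i})) for 0 ≤ t ≤ T. Then for every 0 ≤ t ≤ T and every prefix y_{≤t} ∈ V^t, q^t(y_{≤t}) = β·log( Σ_{y ∈ V^T extending y_{≤t}} π_ref(y | y_{≤t}) · exp(r(y)/β) ); that is, q^t is β times the log of the expectation under π_ref(· | y_{≤t}) of exp(r/β). -/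
open Finset Real

/-- A causal language model over vocabulary `V` with horizon `T`:
for each position `i` and prefix of length `i`, a strictly positive
conditional distribution over the next token. -/
structure CausalLM (V : Type) [Fintype V] (T : ℕ) where
  cond : ∀ i : Fin T, (Fin i → V) → V → ℝ
  cond_pos : ∀ i p v, 0 < cond i p v
  cond_sum_one : ∀ i p, ∑ v, cond i p v = 1

variable {V : Type} [Fintype V] [DecidableEq V] [Nonempty V] {T : ℕ}

/-- The prefix `y_{<i}` of a full sequence `y`. -/
def pref (y : Fin T → V) (i : Fin T) : Fin i → V :=
  fun j => y ⟨j, j.isLt.trans i.isLt⟩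

/-- `π(y) = ∏_{i=1}^T π(y_i | y_{<i})`. -/
noncomputable def fullProb (lm : CausalLM V T) (y : Fin T → V) : ℝ :=
  ∏ i, lm.cond i (pref y i) (y i)

/-- `π(y | y_{≤t}) = ∏_{i=t+1}^T π(y_i | y_{<i})`. -/
noncomputable def condProbFrom (lm : CausalLM V T) (t : ℕ) (y : Fin T → V) : ℝ :=
  ∏ i ∈ Finset.univ.filter (fun i : Fin T => t ≤ i.val), lm.cond i (pref y i) (y i)

/-- The full sequences `y ∈ V^T` extending the prefix `p ∈ V^t`. -/
def completions (t : ℕ) (ht : t ≤ T) (p : Fin t → V) : Finset (Fin T → V) :=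
  Finset.univ.filter (fun y => ∀ j : Fin t, y ⟨j, lt_of_lt_of_le j.isLt ht⟩ = p j)

lemma completions_nonempty (t : ℕ) (ht : t ≤ T) (p : Fin t → V) :
    (completions t ht p).Nonempty := by
  refine ⟨fun i => if h : i.val < t then p ⟨i, h⟩ else Classical.arbitrary V, ?_⟩
  simp only [completions, Finset.mem_filter, Finset.mem_univ, true_and]
  intro j
  simp [j.isLt]

/-- `r(y) = β log (π_θ(y) / π_ref(y))`. -/
noncomputable def rval (lmθ lmRef : CausalLM V T) (β : ℝ) (y : Fin T → V) : ℝ :=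
  β * Real.log (fullProb lmθ y / fullProb lmRef y)

/-- `q^t(y_{≤t}) = ∑_{i=1}^t β log (π_θ(y_i|y_{<i}) / π_ref(y_i|y_{<i}))`. -/
noncomputable def qval (lmθ lmRef : CausalLM V T) (β : ℝ) (t : ℕ) (ht : t ≤ T)
    (p : Fin t → V) : ℝ :=
  ∑ i : Fin t,
    β * Real.log
      (lmθ.cond ⟨i, lt_of_lt_of_le i.isLt ht⟩ (fun j => p ⟨j, j.isLt.trans i.isLt⟩) (p i) /
       lmRef.cond ⟨i, lt_of_lt_of_le i.isLt ht⟩ (fun j => p ⟨j, j.isLt.trans i.isLt⟩) (p i))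

/-- The probability `∏_{i=1}^t π(y_i | y_{<i})` of a prefix `p ∈ V^t`. -/
noncomputable def prefixProb {V : Type} [Fintype V] {T : ℕ} (lm : CausalLM V T)
    (t : ℕ) (ht : t ≤ T) (p : Fin t → V) : ℝ :=
  ∏ i : Fin t,
    lm.cond ⟨i, lt_of_lt_of_le i.isLt ht⟩ (fun j => p ⟨j, j.isLt.trans i.isLt⟩) (p i)

lemma prefixProb_pos {V : Type} [Fintype V] {T : ℕ} (lm : CausalLM V T)
    (t : ℕ) (ht : t ≤ T) (p : Fin t → V) : 0 < prefixProb lm t ht p :=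
  Finset.prod_pos fun _ _ => lm.cond_pos _ _ _

lemma fullProb_pos {V : Type} [Fintype V] {T : ℕ} (lm : CausalLM V T) (y : Fin T → V) :
    0 < fullProb lm y :=
  Finset.prod_pos fun _ _ => lm.cond_pos _ _ _

lemma condProbFrom_pos {V : Type} [Fintype V] {T : ℕ} (lm : CausalLM V T) (t : ℕ)
    (y : Fin T → V) : 0 < condProbFrom lm t y :=
  Finset.prod_pos fun _ _ => lm.cond_pos _ _ _

lemma mem_completions_iff {V : Type} [Fintype V] [DecidableEq V] {T t : ℕ} {ht : t ≤ T}
    {p : Fin t → V} {y : Fin T → V} :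
    y ∈ completions t ht p ↔ p = fun j : Fin t => y ⟨j, lt_of_lt_of_le j.isLt ht⟩ := by
  simp [completions, funext_iff, eq_comm]

lemma fullProb_eq_prefixProb_mul_condProbFrom {V : Type} [Fintype V] [DecidableEq V] {T : ℕ}
    (lm : CausalLM V T) {t : ℕ} {ht : t ≤ T} {p : Fin t → V} {y : Fin T → V}
    (hy : y ∈ completions t ht p) :
    fullProb lm y = prefixProb lm t ht p * condProbFrom lm t y := by
  obtain rfl := mem_completions_iff.mp hy
  rw [fullProb, ← Finset.prod_filter_mul_prod_filter_not _ (fun i : Fin T => t ≤ i.val), mul_comm,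
    condProbFrom]
  congr 1
  refine Finset.prod_bij' (fun i hi => ⟨i, by simpa using hi⟩)
    (fun j _ => ⟨j, lt_of_lt_of_le j.isLt ht⟩) ?_ ?_ ?_ ?_ ?_ <;> simp
  intros
  rfl

lemma condProbFrom_eq_cond_mul {V : Type} [Fintype V] {T : ℕ} (lm : CausalLM V T) {t : ℕ}
    (ht : t < T) (y : Fin T → V) :
    condProbFrom lm t y =
      lm.cond ⟨t, ht⟩ (pref y ⟨t, ht⟩) (y ⟨t, ht⟩) * condProbFrom lm (t + 1) y := by
  have h : Finset.univ.filter (fun i : Fin T => t ≤ i.val) =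
      insert ⟨t, ht⟩ (Finset.univ.filter fun i : Fin T => t + 1 ≤ i.val) := by
    ext i
    simp only [Finset.mem_filter, Finset.mem_univ, true_and, Finset.mem_insert, Fin.ext_iff]
    omega
  rw [condProbFrom, h, Finset.prod_insert (by simp), condProbFrom]

lemma completions_filter_eq {V : Type} [Fintype V] [DecidableEq V] {T t : ℕ} (ht : t < T)
    (p : Fin t → V) (v : V) :
    (completions t ht.le p).filter (fun y => y ⟨t, ht⟩ = v) =
      completions (t + 1) ht (Fin.snoc p v : Fin (t + 1) → V) := by
  ext y
  simp [completions, Fin.forall_fin_succ']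

/-- Conditional probabilities of the completions of a prefix sum to one. -/
lemma sum_condProbFrom_completions {V : Type} [Fintype V] [DecidableEq V] {T : ℕ}
    (lm : CausalLM V T) (t : ℕ) (ht : t ≤ T) (p : Fin t → V) :
    ∑ y ∈ completions t ht p, condProbFrom lm t y = 1 := by
  induction ht using Nat.decreasingInduction with
  | self =>
    have h : completions T le_rfl p = {p} := by
      ext y
      simp [mem_completions_iff, eq_comm]
    have h' : Finset.univ.filter (fun i : Fin T => T ≤ i.val) = ∅ := by
      ext i
      simp
    rw [h, Finset.sum_singleton, condProbFrom, h', Finset.prod_empty]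
  | of_succ t ht ih =>
    rw [← Finset.sum_fiberwise _ (fun y => y ⟨t, ht⟩), ← lm.cond_sum_one ⟨t, ht⟩ p]
    refine Finset.sum_congr rfl fun v _ => ?_
    rw [← mul_one (lm.cond ⟨t, ht⟩ p v), ← ih (Fin.snoc p v), Finset.mul_sum,
      ← completions_filter_eq ht]
    refine Finset.sum_congr rfl fun y hy => ?_
    obtain ⟨hp, rfl⟩ := Finset.mem_filter.mp hy
    obtain rfl := mem_completions_iff.mp hp
    exact condProbFrom_eq_cond_mul lm ht y

lemma qval_eq_mul_log_prefixProb {V : Type} [Fintype V] {T : ℕ} (lmθ lmRef : CausalLM V T)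
    (β : ℝ) (t : ℕ) (ht : t ≤ T) (p : Fin t → V) :
    qval lmθ lmRef β t ht p =
      β * Real.log (prefixProb lmθ t ht p / prefixProb lmRef t ht p) := by
  rw [qval, prefixProb, prefixProb, ← Finset.prod_div_distrib, Real.log_prod, Finset.mul_sum]
  exact fun i _ => (div_pos (lmθ.cond_pos _ _ _) (lmRef.cond_pos _ _ _)).ne'

lemma exp_rval_div {V : Type} [Fintype V] {T : ℕ} (lmθ lmRef : CausalLM V T)
    {β : ℝ} (hβ : β ≠ 0) (y : Fin T → V) :
    Real.exp (rval lmθ lmRef β y / β) = fullProb lmθ y / fullProb lmRef y := by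
  rw [rval, mul_div_cancel_left₀ _ hβ,
    Real.exp_log (div_pos (fullProb_pos lmθ y) (fullProb_pos lmRef y))]

/-- **Proposition 1.** `q^t` is β times the log of the expectation, under the
reference model's conditional distribution over completions of the prefix, of
`exp(r/β)`. -/
theorem prop1_q_is_soft_value
    (V : Type) [Fintype V] [DecidableEq V] [Nonempty V]
    (T : ℕ) (hT : 1 ≤ T) (lmθ lmRef : CausalLM V T) (β : ℝ) (hβ : 0 < β)
    (t : ℕ) (ht : t ≤ T) (p : Fin t → V) :
    qval lmθ lmRef β t ht p =
      β * Real.log (∑ y ∈ completions t ht p,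
        condProbFrom lmRef t y * Real.exp (rval lmθ lmRef β y / β)) := by
  rw [qval_eq_mul_log_prefixProb]
  congr 2
  rw [← mul_one (prefixProb lmθ t ht p / prefixProb lmRef t ht p),
    ← sum_condProbFrom_completions lmθ t ht p, Finset.mul_sum]
  refine Finset.sum_congr rfl fun y hy => ?_
  rw [exp_rval_div lmθ lmRef hβ.ne', fullProb_eq_prefixProb_mul_condProbFrom lmθ hy,
    fullProb_eq_prefixProb_mul_condProbFrom lmRef hy]
  have h₁ := (prefixProb_pos lmRef t ht p).ne'
  have h₂ := (condProbFrom_pos lmRef t y).ne'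
  field_simp
end

section
/- Let ι be a finite nonempty index set, let w : ι → ℝ satisfy w_i > 0 for all i and Σ_{i∈ι} w_i = 1, and let f : ι → ℝ. Then the soft value converges to the expectation in the high-temperature limit: lim_{β → ∞} β·log( Σ_{i∈ι} w_i · exp(f_i/β) ) = Σ_{i∈ι} w_i · f_i. -/
open Finset Real

/-- The cumulant generating function of a finite weight vector of total mass one has the mean as
its derivative at zero. -/
theorem hasDerivAt_log_sum_mul_exp_zero {ι : Type*} [Fintype ι] (w f : ι → ℝ)
    (hsum : ∑ i, w i = 1) :
    HasDerivAt (fun t : ℝ => Real.log (∑ i, w i * Real.exp (t * f i))) (∑ i, w i * f i) 0 := by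
  have h : HasDerivAt (fun t : ℝ => ∑ i, w i * Real.exp (t * f i)) (∑ i, w i * f i) 0 := by
    refine HasDerivAt.fun_sum fun i _ => ?_
    simpa using (((hasDerivAt_id (0 : ℝ)).mul_const (f i)).exp).const_mul (w i)
  simpa [hsum] using h.log (by simp [hsum])

/-- **High-temperature limit (Proposition 2, lower bound attained).** As
`β → ∞`, the soft value `β log ∑ᵢ wᵢ exp(fᵢ/β)` converges to the expectation
`∑ᵢ wᵢ fᵢ`. -/
theorem soft_value_tendsto_mean_atTop
    (ι : Type) [Fintype ι] [Nonempty ι]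
    (w : ι → ℝ) (hw : ∀ i, 0 < w i) (hsum : ∑ i, w i = 1)
    (f : ι → ℝ) :
    Filter.Tendsto (fun β : ℝ => β * Real.log (∑ i, w i * Real.exp (f i / β)))
      Filter.atTop (nhds (∑ i, w i * f i)) := by
  have h := (hasDerivAt_log_sum_mul_exp_zero w f hsum).tendsto_slope_zero_right.comp
    tendsto_inv_atTop_nhdsGT_zero
  refine h.congr fun β => ?_
  simp [hsum, div_eq_inv_mul]
end

section
/- Let ι be a finite nonempty index set, let w : ι → ℝ satisfy w_i > 0 for all i and Σ_{i∈ι} w_i = 1, and let f : ι → ℝ. Then the function β ↦ β·log( Σ_{i∈ι} w_i · exp(f_i/β) ) is nonincreasing on (0, ∞); in particular, for all 0 < β₁ ≤ β₂ one has β₂·log( Σ_i w_i·exp(f_i/β₂) ) ≤ β₁·log( Σ_i w_i·exp(f_i/β₁) ). -/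
open Finset Real

/-- The soft value at a larger temperature is at most the soft value at a smaller one. -/
theorem soft_value_le_of_le {ι : Type*} [Fintype ι] [Nonempty ι]
    {w : ι → ℝ} (hw : ∀ i, 0 < w i) (hsum : ∑ i, w i = 1) (f : ι → ℝ)
    {β₁ β₂ : ℝ} (h₁ : 0 < β₁) (hle : β₁ ≤ β₂) :
    β₂ * Real.log (∑ i, w i * Real.exp (f i / β₂))
      ≤ β₁ * Real.log (∑ i, w i * Real.exp (f i / β₁)) := by
  have h₂ : 0 < β₂ := h₁.trans_le hle
  have hpos : 0 < ∑ i, w i * Real.exp (f i / β₂) :=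
    Finset.sum_pos (fun i _ => mul_pos (hw i) (Real.exp_pos _)) Finset.univ_nonempty
  have key := Real.rpow_arith_mean_le_arith_mean_rpow Finset.univ w
    (fun i => Real.exp (f i / β₂)) (fun i _ => (hw i).le) hsum
    (fun i _ => (Real.exp_pos _).le) ((one_le_div h₁).2 hle)
  have hexp : ∀ i, Real.exp (f i / β₂) ^ (β₂ / β₁) = Real.exp (f i / β₁) := fun i => by
    rw [← Real.exp_mul, div_mul_div_cancel₀ h₂.ne']
  simp only [hexp] at key
  have hlog := Real.log_le_log (Real.rpow_pos_of_pos hpos _) key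
  rw [Real.log_rpow hpos, div_mul_eq_mul_div, div_le_iff₀ h₁] at hlog
  rwa [mul_comm β₁]

/-- **Monotonicity of the soft value in the temperature.** The map
`β ↦ β log ∑ᵢ wᵢ exp(fᵢ/β)` is nonincreasing on `(0, ∞)`; in particular,
for all `0 < β₁ ≤ β₂`, the soft value at `β₂` is at most the soft value at
`β₁`. -/
theorem soft_value_antitone
    (ι : Type) [Fintype ι] [Nonempty ι]
    (w : ι → ℝ) (hw : ∀ i, 0 < w i) (hsum : ∑ i, w i = 1)
    (f : ι → ℝ) :
    AntitoneOn (fun β : ℝ => β * Real.log (∑ i, w i * Real.exp (f i / β))) (Set.Ioi 0)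
    ∧ ∀ β₁ β₂ : ℝ, 0 < β₁ → β₁ ≤ β₂ →
        β₂ * Real.log (∑ i, w i * Real.exp (f i / β₂))
          ≤ β₁ * Real.log (∑ i, w i * Real.exp (f i / β₁)) := by
  have h := fun β₁ β₂ => soft_value_le_of_le hw hsum f (β₁ := β₁) (β₂ := β₂)
  exact ⟨fun β₁ h₁ β₂ _ hle => h β₁ β₂ h₁ hle, h⟩
end
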